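/- Let G be a game structure, U an observation model, M = ({v}, f*, ∼, V) a certainty epistemic model w.r.t. G, G↾f*(v) = (S', ⌢, R', O') the epistemic game tree generated from f*(v), F⊗(M) = (W', ∼', →, V') the run model generated by repeatedly updating U, and g the tracking function from F⊗(M) to G↾f*(v). Then U is non-informative w.r.t. F⊗(M) if and only if g is an isomorphism from F⊗(M) to G↾f*(v) (viewing G↾f*(v) as an epistemic temporal model with epistemic relations ⌢_i, action relations R'_a and valuation O'). -/

import Mathlib

namespace GameRuns

/-- An observation model: an equivalence relation on actions for each player. -/
structure ObsModel (I A : Type) where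
  rel : I → A → A → Prop
  equiv : ∀ i, Equivalence (rel i)

/-- The data of a game structure: a partial transition function and game information. -/
structure GameData (I A P S : Type) where
  R : S → A → Option S
  O : S → I → Set P

/-- `G` is a game structure w.r.t. the player assignment `pl` and the
distinguished information pieces `pa`. -/
def IsGameStructure {I A P S : Type} (pl : A → I) (pa : A → P) (G : GameData I A P S) : Prop :=
  Nonempty S ∧
  (∀ s a b, (G.R s a).isSome → (G.R s b).isSome → pl a = pl b) ∧
  (∀ s a, pa a ∈ G.O s (pl a) ↔ (G.R s a).isSome)

/-- The data of an epistemic model w.r.t. a game structure over states `S`. -/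
structure EpiData (I A P S : Type) (W : Type) where
  f : W → S
  sim : I → W → W → Prop
  V : W → I → Set P

/-- `M` is an epistemic model w.r.t. the game structure `G`. -/
def IsEpiModel {I A P S W : Type} (G : GameData I A P S) (M : EpiData I A P S W) : Prop :=
  Nonempty W ∧
  (∀ i, Equivalence (M.sim i)) ∧
  (∀ i w v, M.sim i w v → G.O (M.f w) i = G.O (M.f v) i) ∧
  (∀ w i, M.V w i = G.O (M.f w) i)

variable {I A P S : Type}

/-- Carrier of the update product `M ⊗ U`. -/
abbrev UpdW (G : GameData I A P S) {W : Type} (M : EpiData I A P S W) : Type :=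
  {x : W × A // (G.R (M.f x.1) x.2).isSome}

/-- The update product `M ⊗ U`. -/
def update (G : GameData I A P S) (U : ObsModel I A) {W : Type} (M : EpiData I A P S W) :
    EpiData I A P S (UpdW G M) where
  f x := (G.R (M.f x.val.1) x.val.2).get x.prop
  sim i x y := M.sim i x.val.1 y.val.1 ∧ U.rel i x.val.2 y.val.2 ∧
    G.O ((G.R (M.f x.val.1) x.val.2).get x.prop) i =
      G.O ((G.R (M.f y.val.1) y.val.2).get y.prop) i
  V x i := G.O ((G.R (M.f x.val.1) x.val.2).get x.prop) i

/-- The data of an epistemic temporal model. -/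
structure ETLData (I A P : Type) (W : Type) where
  sim : I → W → W → Prop
  trans : A → W → W → Prop
  V : W → I → Set P

/-- `N` is an epistemic temporal model: nonempty carrier, equivalence relations. -/
def IsETL {W : Type} (N : ETLData I A P W) : Prop :=
  Nonempty W ∧ ∀ i, Equivalence (N.sim i)

/-- The set of actions available at a state of an epistemic temporal model. -/
def Act {W : Type} (N : ETLData I A P W) (s : W) : Set A := {a | ∃ t, N.trans a s t}

/-- Normality of an epistemic temporal model w.r.t. an observation model:
no miracles, perfect recall, determinism, exclusive turns, info and knowledge of
own information. -/
def Normal (pl : A → I) (pa : A → P) (U : ObsModel I A) {W : Type}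
    (N : ETLData I A P W) : Prop :=
  (∀ i a b s s' t t', N.sim i s s' → N.trans a s' t' → N.trans b s t →
      U.rel i b a → N.V t i = N.V t' i → N.sim i t t') ∧
  (∀ i a s t t', N.trans a s t → N.sim i t t' →
      ∃ s' b, N.sim i s s' ∧ U.rel i a b ∧ N.trans b s' t') ∧
  (∀ a s t t', N.trans a s t → N.trans a s t' → t = t') ∧
  (∀ s : W, (Act N s).Nonempty → ∃ j, ∀ a ∈ Act N s, pl a = j) ∧
  (∀ s a, pa a ∈ N.V s (pl a) ↔ ∃ t, N.trans a s t) ∧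
  (∀ i w v, N.sim i w v → N.V w i = N.V v i)

/-- A bundled epistemic model (carrier together with the model). -/
structure BEpi (I A P S : Type) where
  W : Type
  M : EpiData I A P S W

/-- Bundled update. -/
def bUpdate (G : GameData I A P S) (U : ObsModel I A) (B : BEpi I A P S) : BEpi I A P S :=
  ⟨UpdW G B.M, update G U B.M⟩

/-- Iterated update `M ⊗ U^k`. -/
def iter (G : GameData I A P S) (U : ObsModel I A) (B : BEpi I A P S) : ℕ → BEpi I A P S
  | 0 => B
  | k + 1 => bUpdate G U (iter G U B k)

/-- Carrier of the run model generated by repeatedly updating `U`: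
states of level `k` are the states of `M ⊗ U^k`. -/
abbrev RunW (G : GameData I A P S) (U : ObsModel I A) (B : BEpi I A P S) : Type :=
  Σ k : ℕ, (iter G U B k).W

/-- The successor state `(w, a)` of `w` in the next level of the run model. -/
def stepUp (G : GameData I A P S) (U : ObsModel I A) (B : BEpi I A P S) (k : ℕ)
    (w : (iter G U B k).W) (a : A) (h : (G.R ((iter G U B k).M.f w) a).isSome) :
    (iter G U B (k + 1)).W :=
  ⟨(w, a), h⟩

/-- Epistemic relation of the run model. -/
def runSim (G : GameData I A P S) (U : ObsModel I A) (B : BEpi I A P S) (i : I) :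
    RunW G U B → RunW G U B → Prop := fun x y =>
  ∃ h : x.1 = y.1,
    (iter G U B y.1).M.sim i (cast (congrArg (fun k => (iter G U B k).W) h) x.2) y.2

/-- Action relation of the run model. -/
def runTrans (G : GameData I A P S) (U : ObsModel I A) (B : BEpi I A P S) (a : A) :
    RunW G U B → RunW G U B → Prop := fun x y =>
  ∃ h : (G.R ((iter G U B x.1).M.f x.2) a).isSome,
    y = ⟨x.1 + 1, stepUp G U B x.1 x.2 a h⟩

/-- The run model `F⊗(M)` generated by repeatedly updating `U`. -/
def runModel (G : GameData I A P S) (U : ObsModel I A) (B : BEpi I A P S) :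
    ETLData I A P (RunW G U B) where
  sim := runSim G U B
  trans := runTrans G U B
  V x i := (iter G U B x.1).M.V x.2 i

/-- The induced state assignment function of the run model. -/
def runF (G : GameData I A P S) (U : ObsModel I A) (B : BEpi I A P S) :
    RunW G U B → S := fun x => (iter G U B x.1).M.f x.2



section More
variable {I A P S : Type}

/-- The state reached by following a list of actions from `s`, if it exists. -/
def runPath (G : GameData I A P S) : S → List A → Option S
  | s, [] => some s
  | s, a :: l => (G.R s a).bind fun t => runPath G t l

theorem runPath_append (G : GameData I A P S) (s : S) (l : List A) (a : A) :
    runPath G s (l ++ [a]) = (runPath G s l).bind fun t => G.R t a := by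
  induction l generalizing s with
  | nil => simp [runPath]
  | cons b l ih =>
    simp only [List.cons_append, runPath]
    cases h : G.R s b with
    | none => simp
    | some t => simp [ih]

/-- The initial world and the sequence of actions of a state of the run model. -/
def runActs (G : GameData I A P S) (U : ObsModel I A) (B : BEpi I A P S) :
    (k : ℕ) → (iter G U B k).W → B.W × List A
  | 0, w => (w, [])
  | k + 1, w =>
      ((runActs G U B k w.val.1).1, (runActs G U B k w.val.1).2 ++ [w.val.2])

theorem runActs_path (G : GameData I A P S) (U : ObsModel I A) (B : BEpi I A P S) :
    ∀ (k : ℕ) (w : (iter G U B k).W),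
      runPath G (B.M.f (runActs G U B k w).1) (runActs G U B k w).2 =
        some ((iter G U B k).M.f w) := by
  intro k
  induction k with
  | zero => intro w; rfl
  | succ k ih =>
    intro w
    have h1 := ih w.val.1
    show runPath G _ _ = some ((update G U (iter G U B k).M).f w)
    rw [show runActs G U B (k + 1) w =
        ((runActs G U B k w.val.1).1, (runActs G U B k w.val.1).2 ++ [w.val.2]) from rfl]
    rw [runPath_append, h1]
    exact (Option.some_get w.prop).symm

/-- Carrier of the epistemic game tree generatedfrom `s`: valid histories. -/
abbrev TreeW (G : GameData I A P S) (s : S) : Type := {l : List A // (runPath G s l).isSome}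

/-- The epistemic game tree generated from `s` with perfect recall,
viewed as an epistemic temporal model. -/
def tree (G : GameData I A P S) (s : S) : ETLData I A P (TreeW G s) where
  sim i w u := w.val.length = u.val.length ∧
    ∀ k, (runPath G s (w.val.take k)).map (fun t => G.O t i) =
      (runPath G s (u.val.take k)).map (fun t => G.O t i)
  trans a w u := u.val = w.val ++ [a]
  V w i := G.O ((runPath G s w.val).get w.prop) i

/-- The tracking function from the run model of a certainty epistemic model to the
epistemic game tree generated from the (common-knowledge) initial state. -/
def tracking (G : GameData I A P S) (U : ObsModel I A) {W : Type} (M : EpiData I A P S W)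
    (v : W) (hv : ∀ x : W, x = v) (x : RunW G U ⟨W, M⟩) : TreeW G (M.f v) :=
  ⟨(runActs G U ⟨W, M⟩ x.1 x.2).2, by
    have h : runPath G (M.f (runActs G U ⟨W, M⟩ x.1 x.2).1)
        (runActs G U ⟨W, M⟩ x.1 x.2).2 = some ((iter G U ⟨W, M⟩ x.1).M.f x.2) :=
      runActs_path G U ⟨W, M⟩ x.1 x.2
    rw [hv (runActs G U ⟨W, M⟩ x.1 x.2).1] at h
    rw [h]
    rfl⟩

/-- `U` is non-informative w.r.t. an epistemic temporal model. -/
def NonInformative (U : ObsModel I A) {W : Type} (N : ETLData I A P W) : Prop :=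
  ∀ i a b w u s t, N.trans a w s → N.trans b u t → N.sim i w u →
    ¬ U.rel i a b → N.V s i ≠ N.V t i

/-- Isomorphism of epistemic temporal models. -/
def IsIso {W W' : Type} (N : ETLData I A P W) (N' : ETLData I A P W') (g : W → W') : Prop :=
  Function.Bijective g ∧
  (∀ i x y, N.sim i x y ↔ N'.sim i (g x) (g y)) ∧
  (∀ a x y, N.trans a x y ↔ N'.trans a (g x) (g y)) ∧
  (∀ x i, N.V x i = N'.V (g x) i)

/-- p-morphisms between epistemic temporal models. -/
def IsPMorphism {W W' : Type} (N : ETLData I A P W) (N' : ETLData I A P W')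
    (g : W → W') : Prop :=
  (∀ w i, N.V w i = N'.V (g w) i) ∧
  (∀ i w u, N.sim i w u → N'.sim i (g w) (g u)) ∧
  (∀ i w s, N'.sim i (g w) s → ∃ v, g v = s ∧ N.sim i w v) ∧
  (∀ a w u, N.trans a w u → N'.trans a (g w) (g u)) ∧
  (∀ a w s, N'.trans a (g w) s → ∃ v, g v = s ∧ N.trans a w v)

/-- The induced epistemic game structure `E(G)`, viewed as an epistemic temporal model. -/
def egame (G : GameData I A P S) : ETLData I A P S where
  sim i s t := G.O s i = G.O t i
  trans a s t := G.R s a = some t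
  V s i := G.O s i

/-- `G` is a perfect information game: the induced epistemic relations are the identity. -/
def PerfectInfo (G : GameData I A P S) : Prop :=
  ∀ i s t, G.O s i = G.O t i → s = t

/-- The game induced by an epistemic temporal model: `R(s,a) = t` iff `s →_a t`. -/
noncomputable def inducedGame {W : Type} (N : ETLData I A P W) : GameData I A P W where
  R s a := @dite _ (∃ t, N.trans a s t) (Classical.propDecidable _)
    (fun h => some h.choose) (fun _ => none)
  O := N.V

/-- The epistemic part induced by an epistemic temporal model. -/
def epiPart {W : Type} (N : ETLData I A P W) : EpiData I A P W W where
  f := id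
  sim := N.sim
  V := N.V

theorem inducedGame_isSome {W : Type} (N : ETLData I A P W) {a : A} {s t : W}
    (h : N.trans a s t) : ((inducedGame N).R s a).isSome := by
  show (@dite _ (∃ t, N.trans a s t) (Classical.propDecidable _)
    (fun h => some h.choose) (fun _ => none)).isSome
  rw [dif_pos ⟨t, h⟩]
  rfl

end More
section Lang
variable {I A P S : Type}

/-- The dynamic epistemic language LDEL. -/
inductive LDEL (I A P : Type) : Type where
  | top : LDEL I A P
  | atom : P → I → LDEL I A P
  | neg : LDEL I A P → LDEL I A P
  | conj : LDEL I A P → LDEL I A P → LDEL I A P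
  | know : I → LDEL I A P → LDEL I A P
  | box : A → LDEL I A P → LDEL I A P

/-- Implication, defined from negation and conjunction. -/
def impF (φ ψ : LDEL I A P) : LDEL I A P := .neg (.conj φ (.neg ψ))

/-- Disjunction. -/
def orF (φ ψ : LDEL I A P) : LDEL I A P := .neg (.conj (.neg φ) (.neg ψ))

/-- Biconditional. -/
def iffF (φ ψ : LDEL I A P) : LDEL I A P := .conj (impF φ ψ) (impF ψ φ)

/-- Diamond `⟨a⟩φ`. -/
def diaF (a : A) (φ : LDEL I A P) : LDEL I A P := .neg (.box a (.neg φ))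

/-- The dual knowledge modality `K̂_i φ`. -/
def khatF (i : I) (φ : LDEL I A P) : LDEL I A P := .neg (.know i (.neg φ))

/-- Finite conjunction. -/
def bigAnd : List (LDEL I A P) → LDEL I A P
  | [] => .top
  | φ :: l => .conj φ (bigAnd l)

/-- Finite disjunction. -/
def bigOr : List (LDEL I A P) → LDEL I A P
  | [] => .neg .top
  | φ :: l => orF φ (bigOr l)

/-- The characteristic formula `φ^o_i` of a combination of information pieces,
where `L1` enumerates the pieces in `B` and `L2` those not in `B`. -/
def charF (i : I) (L1 L2 : List P) : LDEL I A P :=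
  .conj (bigAnd (L1.map (fun p => LDEL.atom p i)))
    (bigAnd (L2.map (fun p => LDEL.neg (LDEL.atom p i))))

/-- `TURN_i`, given an enumeration `l` of the actions of player `i`. -/
def turnF (l : List A) : LDEL I A P := bigOr (l.map (fun a => diaF a LDEL.top))

/-- Propositional evaluation treating atoms, `K_i ψ` and `[a]ψ` as atomic. -/
def propEval (v : LDEL I A P → Prop) : LDEL I A P → Prop
  | .top => True
  | .neg φ => ¬ propEval v φ
  | .conj φ ψ => propEval v φ ∧ propEval v ψ
  | φ => v φ

/-- The dynamic (DEL-style) semantics `⊨` over epistemic models w.r.t. a game structure. -/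
def dynSat (G : GameData I A P S) (U : ObsModel I A) :
    LDEL I A P → (W : Type) → EpiData I A P S W → W → Prop
  | .top, _, _, _ => True
  | .atom p i, _, M, w => p ∈ M.V w i
  | .neg φ, W, M, w => ¬ dynSat G U φ W M w
  | .conj φ ψ, W, M, w => dynSat G U φ W M w ∧ dynSat G U ψ W M w
  | .know i φ, W, M, w => ∀ v, M.sim i w v → dynSat G U φ W M v
  | .box a φ, _, M, w => ∀ h : (G.R (M.f w) a).isSome,
      dynSat G U φ (UpdW G M) (update G U M) ⟨(w, a), h⟩

/-- The epistemic temporal (ETL-style) semantics `⊩`. -/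
def etlSat {W : Type} (N : ETLData I A P W) : LDEL I A P → W → Prop
  | .top, _ => True
  | .atom p i, w => p ∈ N.V w i
  | .neg φ, w => ¬ etlSat N φ w
  | .conj φ ψ, w => etlSat N φ w ∧ etlSat N ψ w
  | .know i φ, w => ∀ v, N.sim i w v → etlSat N φ v
  | .box a φ, w => ∀ v, N.trans a w v → etlSat N φ v

/-- `Z` is a `G`-bisimulation between two epistemic models w.r.t. `G`. -/
def IsGBisim {W W' : Type} (G : GameData I A P S) (M : EpiData I A P S W)
    (N : EpiData I A P S W') (Z : W → W' → Prop) : Prop :=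
  ∀ w u, Z w u →
    M.f w = N.f u ∧
    (∀ i w', M.sim i w w' → ∃ u', N.sim i u u' ∧ Z w' u') ∧
    (∀ i u', N.sim i u u' → ∃ w', M.sim i w w' ∧ Z w' u')

/-- Pointed `G`-bisimilarity. -/
def GBisimilar {W W' : Type} (G : GameData I A P S) (M : EpiData I A P S W)
    (N : EpiData I A P S W') (w : W) (u : W') : Prop :=
  ∃ Z, IsGBisim G M N Z ∧ Z w u

/-- The proof system SIG. -/
inductive SIG (pl : A → I) (pa : A → P) (U : ObsModel I A) : LDEL I A P → Prop where
  | taut {φ : LDEL I A P} : (∀ v, propEval v φ) → SIG pl pa U φ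
  | distK (i : I) (φ ψ : LDEL I A P) :
      SIG pl pa U (impF (.know i (impF φ ψ)) (impF (.know i φ) (.know i ψ)))
  | distB (a : A) (φ ψ : LDEL I A P) :
      SIG pl pa U (impF (.box a (impF φ ψ)) (impF (.box a φ) (.box a ψ)))
  | axT (i : I) (φ : LDEL I A P) : SIG pl pa U (impF (.know i φ) φ)
  | ax4 (i : I) (φ : LDEL I A P) :
      SIG pl pa U (impF (.know i φ) (.know i (.know i φ)))
  | ax5 (i : I) (φ : LDEL I A P) :
      SIG pl pa U (impF (.neg (.know i φ)) (.know i (.neg (.know i φ))))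
  | nm (i : I) (a b : A) (φ : LDEL I A P) (B : Set P) (L1 L2 : List P)
      (h1 : ∀ p, p ∈ L1 ↔ p ∈ B) (h2 : ∀ p, p ∈ L2 ↔ p ∉ B) (hab : U.rel i a b) :
      SIG pl pa U (impF (khatF i (diaF b (.conj φ (charF i L1 L2))))
        (.box a (impF (charF i L1 L2) (khatF i φ))))
  | pr (i : I) (a : A) (φ : LDEL I A P) (L : List A) (hL : ∀ b, b ∈ L ↔ U.rel i a b) :
      SIG pl pa U (impF (diaF a (khatF i φ))
        (bigOr (L.map (fun b => khatF i (diaF b φ)))))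
  | det (a : A) (φ : LDEL I A P) : SIG pl pa U (impF (diaF a φ) (.box a φ))
  | exturn (i : I) (LA : I → List A) (hLA : ∀ j a, a ∈ LA j ↔ pl a = j)
      (LI : List I) (hLI : ∀ j, j ∈ LI ↔ j ≠ i) :
      SIG pl pa U (impF (turnF (LA i))
        (bigAnd (LI.map (fun j => LDEL.neg (turnF (LA j))))))
  | info (a : A) : SIG pl pa U (iffF (diaF a .top) (.atom (pa a) (pl a)))
  | ke (p : P) (i : I) :
      SIG pl pa U (.conj (impF (.atom p i) (.know i (.atom p i)))
        (impF (.neg (.atom p i)) (.know i (.neg (.atom p i)))))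
  | mp {φ ψ : LDEL I A P} : SIG pl pa U (impF φ ψ) → SIG pl pa U φ → SIG pl pa U ψ
  | necK (i : I) {φ : LDEL I A P} : SIG pl pa U φ → SIG pl pa U (.know i φ)
  | necB (a : A) {φ : LDEL I A P} : SIG pl pa U φ → SIG pl pa U (.box a φ)

/-- A set of formulas is SIG-inconsistent if the negation of the conjunction of some
finite list of its members is derivable. -/
def Inconsistent (pl : A → I) (pa : A → P) (U : ObsModel I A)
    (Γ : Set (LDEL I A P)) : Prop :=
  ∃ L : List (LDEL I A P), (∀ φ ∈ L, φ ∈ Γ) ∧ SIG pl pa U (.neg (bigAnd L))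

/-- Maximally SIG-consistent sets. -/
def MCS (pl : A → I) (pa : A → P) (U : ObsModel I A) (Γ : Set (LDEL I A P)) : Prop :=
  ¬ Inconsistent pl pa U Γ ∧ ∀ Δ, Γ ⊂ Δ → Inconsistent pl pa U Δ

/-- Carrier of the canonical model: all maximally consistent sets. -/
abbrev CanW (pl : A → I) (pa : A → P) (U : ObsModel I A) : Type :=
  {Γ : Set (LDEL I A P) // MCS pl pa U Γ}

/-- The canonical model of SIG. -/
def canonical (pl : A → I) (pa : A → P) (U : ObsModel I A) :
    ETLData I A P (CanW pl pa U) where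
  sim i w u := ∀ φ, LDEL.know i φ ∈ w.val → φ ∈ u.val
  trans a w u := ∀ φ, LDEL.box a φ ∈ w.val → φ ∈ u.val
  V w i := {p | LDEL.atom p i ∈ w.val}

end Lang

section Tracking
variable {I A P S : Type}

theorem runActs_length (G : GameData I A P S) (U : ObsModel I A) (B : BEpi I A P S) :
    ∀ (k : ℕ) (w : (iter G U B k).W), (runActs G U B k w).2.length = k
  | 0, _ => rfl
  | k + 1, w => by
    have h : (runActs G U B (k + 1) w).2 =
      (runActs G U B k w.val.1).2 ++ [w.val.2] := rfl
    rw [h, List.length_append, runActs_length G U B k w.val.1, List.length_singleton]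

theorem runActs_injective (G : GameData I A P S) (U : ObsModel I A) (B : BEpi I A P S) :
    ∀ k : ℕ, Function.Injective (runActs G U B k)
  | 0 => fun _ _ h => congrArg Prod.fst h
  | k + 1 => fun w u h => by
    have h₁ : (runActs G U B k w.val.1).1 = (runActs G U B k u.val.1).1 :=
      (Prod.ext_iff.1 h).1
    have h₂ : (runActs G U B k w.val.1).2 ++ [w.val.2] =
      (runActs G U B k u.val.1).2 ++ [u.val.2] := (Prod.ext_iff.1 h).2
    obtain ⟨h₃, h₄⟩ := List.append_inj' h₂ rfl
    exact Subtype.ext (Prod.ext (runActs_injective G U B k (Prod.ext h₁ h₃))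
      (List.singleton_injective h₄))

theorem exists_runActs_eq (G : GameData I A P S) (U : ObsModel I A) (B : BEpi I A P S)
    (v : B.W) (l : List A) (hl : (runPath G (B.M.f v) l).isSome) :
    ∃ x : RunW G U B, runActs G U B x.1 x.2 = (v, l) := by
  induction l using List.reverseRecOn with
  | nil => exact ⟨⟨0, v⟩, rfl⟩
  | append_singleton l a ih =>
    rw [runPath_append] at hl
    obtain ⟨⟨k, w⟩, hw⟩ := ih (Option.isSome_of_isSome_bind hl)
    have hp := runActs_path G U B k w
    simp only at hw
    rw [hw] at hp
    rw [hp] at hl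
    refine ⟨⟨k + 1, stepUp G U B k w a hl⟩, ?_⟩
    change ((runActs G U B k w).1, (runActs G U B k w).2 ++ [a]) = _
    rw [hw]

theorem iter_V (G : GameData I A P S) (U : ObsModel I A) (B : BEpi I A P S)
    (hB : ∀ w i, B.M.V w i = G.O (B.M.f w) i) :
    ∀ (k : ℕ) (w : (iter G U B k).W) (i : I),
      (iter G U B k).M.V w i = G.O ((iter G U B k).M.f w) i
  | 0 => hB
  | _ + 1 => fun _ _ => rfl

/-- The relation of perfect-recall indistinguishability on histories starting at `s`. -/
def SameObs (G : GameData I A P S) (s : S) (i : I) (l m : List A) : Prop :=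
  l.length = m.length ∧
    ∀ k, (runPath G s (l.take k)).map (fun t => G.O t i) =
      (runPath G s (m.take k)).map (fun t => G.O t i)

theorem sameObs_append_singleton (G : GameData I A P S) (s : S) (i : I) {l m : List A}
    (h : l.length = m.length) (a b : A) :
    SameObs G s i (l ++ [a]) (m ++ [b]) ↔ SameObs G s i l m ∧
      (runPath G s (l ++ [a])).map (fun t => G.O t i) =
        (runPath G s (m ++ [b])).map (fun t => G.O t i) := by
  constructor
  · rintro ⟨-, hk⟩
    refine ⟨⟨h, fun k => ?_⟩, ?_⟩
    · have := hk (min k l.length)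
      rwa [List.take_append_of_le_length (min_le_right _ _),
        List.take_append_of_le_length (h ▸ min_le_right _ _), ← List.take_eq_take_min,
        h, ← List.take_eq_take_min] at this
    · have := hk (l.length + 1)
      rwa [List.take_of_length_le (by simp), List.take_of_length_le (by simp [h])] at this
  · rintro ⟨⟨-, hk⟩, hlast⟩
    refine ⟨by simp [h], fun k => ?_⟩
    rcases le_or_gt k l.length with hkl | hkl
    · rw [List.take_append_of_le_length hkl, List.take_append_of_le_length (h ▸ hkl)]
      exact hk k
    · rwa [List.take_of_length_le (by simp; omega), List.take_of_length_le (by simp; omega)]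

theorem runPath_certainty (G : GameData I A P S) (U : ObsModel I A) (B : BEpi I A P S)
    (v : B.W) (hv : ∀ x : B.W, x = v) (k : ℕ) (w : (iter G U B k).W) :
    runPath G (B.M.f v) (runActs G U B k w).2 = some ((iter G U B k).M.f w) := by
  have h := runActs_path G U B k w
  rwa [hv (runActs G U B k w).1] at h

/-- Over a certainty epistemic model, a non-informative observation model yields exactly the
perfect-recall epistemic relations. -/
theorem iter_sim_iff_sameObs (G : GameData I A P S) (U : ObsModel I A) (B : BEpi I A P S)
    (hrefl : ∀ i w, B.M.sim i w w) (v : B.W) (hv : ∀ x : B.W, x = v)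
    (hN : NonInformative U (runModel G U B)) (i : I) :
    ∀ (k : ℕ) (w u : (iter G U B k).W), (iter G U B k).M.sim i w u ↔
      SameObs G (B.M.f v) i (runActs G U B k w).2 (runActs G U B k u).2
  | 0, w, u => by
    have hwu : w = u := (hv w).trans (hv u).symm
    subst hwu
    exact iff_of_true (hrefl i w) ⟨rfl, fun _ => rfl⟩
  | k + 1, w, u => by
    have hlen : (runActs G U B k w.val.1).2.length = (runActs G U B k u.val.1).2.length := by
      rw [runActs_length, runActs_length]
    have hw : runPath G (B.M.f v) ((runActs G U B k w.val.1).2 ++ [w.val.2]) =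
      some ((iter G U B (k + 1)).M.f w) := runPath_certainty G U B v hv (k + 1) w
    have hu : runPath G (B.M.f v) ((runActs G U B k u.val.1).2 ++ [u.val.2]) =
      some ((iter G U B (k + 1)).M.f u) := runPath_certainty G U B v hv (k + 1) u
    change ((iter G U B k).M.sim i w.val.1 u.val.1 ∧ U.rel i w.val.2 u.val.2 ∧
      G.O ((iter G U B (k + 1)).M.f w) i = G.O ((iter G U B (k + 1)).M.f u) i) ↔
      SameObs G (B.M.f v) i ((runActs G U B k w.val.1).2 ++ [w.val.2])
        ((runActs G U B k u.val.1).2 ++ [u.val.2])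
    rw [sameObs_append_singleton G _ i hlen, hw, hu, Option.map_some, Option.map_some,
      Option.some_inj, ← iter_sim_iff_sameObs G U B hrefl v hv hN i k]
    refine ⟨fun h => ⟨h.1, h.2.2⟩, fun h => ⟨h.1, ?_, h.2⟩⟩
    by_contra hrel
    exact hN i w.val.2 u.val.2 ⟨k, w.val.1⟩ ⟨k, u.val.1⟩ ⟨k + 1, w⟩ ⟨k + 1, u⟩
      ⟨w.prop, rfl⟩ ⟨u.prop, rfl⟩ ⟨rfl, h.1⟩ hrel h.2

theorem tracking_bijective (G : GameData I A P S) (U : ObsModel I A) {W : Type}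
    (M : EpiData I A P S W) (v : W) (hv : ∀ x : W, x = v) :
    Function.Bijective (tracking G U M v hv) := by
  constructor
  · rintro ⟨k, w⟩ ⟨j, u⟩ h
    have h₂ : (runActs G U ⟨W, M⟩ k w).2 = (runActs G U ⟨W, M⟩ j u).2 :=
      congrArg Subtype.val h
    obtain rfl : k = j := by
      have := congrArg List.length h₂
      rwa [runActs_length, runActs_length] at this
    have h₁ : (runActs G U ⟨W, M⟩ k w).1 = (runActs G U ⟨W, M⟩ k u).1 :=
      (hv _).trans (hv _).symm
    rw [runActs_injective G U ⟨W, M⟩ k (Prod.ext h₁ h₂)]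
  · rintro ⟨l, hl⟩
    obtain ⟨x, hx⟩ := exists_runActs_eq G U ⟨W, M⟩ v l hl
    exact ⟨x, Subtype.ext (congrArg Prod.snd hx)⟩

theorem runModel_trans_iff_tracking (G : GameData I A P S) (U : ObsModel I A) {W : Type}
    (M : EpiData I A P S W) (v : W) (hv : ∀ x : W, x = v) (a : A) (x y : RunW G U ⟨W, M⟩) :
    (runModel G U ⟨W, M⟩).trans a x y ↔
      (tree G (M.f v)).trans a (tracking G U M v hv x) (tracking G U M v hv y) := by
  constructor
  · rintro ⟨h, rfl⟩
    rfl
  · intro h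
    have hval : (tracking G U M v hv y).val = (runActs G U ⟨W, M⟩ x.1 x.2).2 ++ [a] := h
    have hp := (tracking G U M v hv y).prop
    have hx : runPath G (M.f v) (runActs G U ⟨W, M⟩ x.1 x.2).2 = _ :=
      runPath_certainty G U ⟨W, M⟩ v hv x.1 x.2
    rw [hval, runPath_append, hx] at hp
    exact ⟨hp, (tracking_bijective G U M v hv).1 (Subtype.ext hval)⟩

theorem runModel_V_eq_tracking (G : GameData I A P S) (U : ObsModel I A) {W : Type}
    (M : EpiData I A P S W) (hV : ∀ w i, M.V w i = G.O (M.f w) i)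
    (v : W) (hv : ∀ x : W, x = v) (x : RunW G U ⟨W, M⟩) (i : I) :
    (runModel G U ⟨W, M⟩).V x i = (tree G (M.f v)).V (tracking G U M v hv x) i := by
  refine (iter_V G U ⟨W, M⟩ hV x.1 x.2 i).trans (congrArg (fun t => G.O t i) ?_)
  exact (Option.get_of_eq_some _ (runPath_certainty G U ⟨W, M⟩ v hv x.1 x.2)).symm

theorem runModel_sim_iff_tracking (G : GameData I A P S) (U : ObsModel I A) {W : Type}
    (M : EpiData I A P S W) (hrefl : ∀ i w, M.sim i w w) (v : W) (hv : ∀ x : W, x = v)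
    (hN : NonInformative U (runModel G U ⟨W, M⟩)) (i : I) (x y : RunW G U ⟨W, M⟩) :
    (runModel G U ⟨W, M⟩).sim i x y ↔
      (tree G (M.f v)).sim i (tracking G U M v hv x) (tracking G U M v hv y) := by
  obtain ⟨k, w⟩ := x
  obtain ⟨j, u⟩ := y
  have key := iter_sim_iff_sameObs G U ⟨W, M⟩ hrefl v hv hN i
  constructor
  · rintro ⟨h, hs⟩
    obtain rfl : k = j := h
    exact (key k w u).1 hs
  · intro h
    have hlen : (runActs G U ⟨W, M⟩ k w).2.length = (runActs G U ⟨W, M⟩ j u).2.length := h.1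
    rw [runActs_length, runActs_length] at hlen
    subst hlen
    exact ⟨rfl, (key k w u).2 h⟩

theorem nonInformative_of_isIso_tracking (G : GameData I A P S) (U : ObsModel I A) {W : Type}
    (M : EpiData I A P S W) (v : W) (hv : ∀ x : W, x = v)
    (hiso : IsIso (runModel G U ⟨W, M⟩) (tree G (M.f v)) (tracking G U M v hv)) :
    NonInformative U (runModel G U ⟨W, M⟩) := by
  rintro i a b ⟨k, w⟩ ⟨j, u⟩ s t ⟨hs, rfl⟩ ⟨ht, rfl⟩ hsim hrel heq
  obtain rfl : k = j := hsim.1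
  have hobs : SameObs G (M.f v) i (runActs G U ⟨W, M⟩ k w).2 (runActs G U ⟨W, M⟩ k u).2 :=
    (hiso.2.1 i _ _).1 hsim
  have hstep : SameObs G (M.f v) i ((runActs G U ⟨W, M⟩ k w).2 ++ [a])
      ((runActs G U ⟨W, M⟩ k u).2 ++ [b]) := by
    rw [sameObs_append_singleton G _ i hobs.1]
    refine ⟨hobs, ?_⟩
    have hw : runPath G (M.f v) ((runActs G U ⟨W, M⟩ k w).2 ++ [a]) = _ :=
      runPath_certainty G U ⟨W, M⟩ v hv (k + 1) (stepUp G U ⟨W, M⟩ k w a hs)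
    have hu : runPath G (M.f v) ((runActs G U ⟨W, M⟩ k u).2 ++ [b]) = _ :=
      runPath_certainty G U ⟨W, M⟩ v hv (k + 1) (stepUp G U ⟨W, M⟩ k u b ht)
    rw [hw, hu]
    exact congrArg some heq
  obtain ⟨_, h⟩ := (hiso.2.1 i ⟨k + 1, stepUp G U ⟨W, M⟩ k w a hs⟩
    ⟨k + 1, stepUp G U ⟨W, M⟩ k u b ht⟩).2 hstep
  exact hrel h.2.1

end Tracking

section Statements
variable {I A P S W W' : Type}

theorem statement4 [Fintype I] [Fintype A] [Fintype P] [Nonempty I] [Nonempty A]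
    (pl : A → I) (pa : A → P) (U : ObsModel I A)
    (G : GameData I A P S) (hG : IsGameStructure pl pa G)
    (M : EpiData I A P S W) (hM : IsEpiModel G M)
    (v : W) (hv : ∀ x : W, x = v) :
    NonInformative U (runModel G U ⟨W, M⟩) ↔
      IsIso (runModel G U ⟨W, M⟩) (tree G (M.f v)) (tracking G U M v hv) := by
  obtain ⟨-, hequiv, -, hV⟩ := hM
  exact ⟨fun hN => ⟨tracking_bijective G U M v hv,
      runModel_sim_iff_tracking G U M (fun i => (hequiv i).refl) v hv hN,
      runModel_trans_iff_tracking G U M v hv, runModel_V_eq_tracking G U M hV v hv⟩,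
    nonInformative_of_isIso_tracking G U M v hv⟩

end Statements
end GameRuns
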